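/- arXiv:1711.08113 — 9 statements merged into one kernel-verified Lean document; each statement's English description precedes it below -/
import Mathlib

section
/- For every integer k ≥ 1 and parameters ε ∈ (0, 1/2) and η ∈ [0, 1/4), and for every function f mapping probability distributions on {0,1}^k to probability distributions on {0,1}, there exist a distribution p on {0,1}, a distribution p' on {0,1} with Δ(p, p') ≤ η, and a probability distribution N on {0,1}^k such that the output q̂ = f((1−ε)·p'^⊗k + ε·N) satisfies ‖p − q̂‖₁ ≥ 2η + ε/√(2k). (In other words, no estimator that sees only the ε-corrupted mixture of k-fold product samples can recover p to ℓ₁ error better than 2η + ε/√(2k), even with infinitely many batches.) -/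
open Finset

/-- `p` is a probability distribution on the finite type `α`. -/
def IsDist {α : Type*} [Fintype α] (p : α → ℝ) : Prop :=
  (∀ x, 0 ≤ p x) ∧ ∑ x, p x = 1

/-- Total variation distance between two distributions on a finite type. -/
noncomputable def TV {α : Type*} [Fintype α] (p q : α → ℝ) : ℝ :=
  (1 / 2) * ∑ x, |p x - q x|

/-- Two distributions within total variation `ε` become indistinguishable after suitable
`ε`-contaminations. -/
lemma exists_contamination_eq {α : Type*} [Fintype α] {P Q : α → ℝ} {ε : ℝ}
    (hP : IsDist P) (hQ : IsDist Q) (hε0 : 0 < ε) (hε1 : ε ≤ 1) (h : TV P Q ≤ ε) :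
    ∃ N₁ N₂ : α → ℝ, IsDist N₁ ∧ IsDist N₂ ∧
      ∀ x, (1 - ε) * P x + ε * N₁ x = (1 - ε) * Q x + ε * N₂ x := by
  have hT0 : 0 ≤ TV P Q := mul_nonneg (by norm_num) (Finset.sum_nonneg fun _ _ => abs_nonneg _)
  have hTsum : ∑ x, |P x - Q x| = 2 * TV P Q := by unfold TV; ring
  set c := ε - (1 - ε) * TV P Q with hc
  have hc0 : 0 ≤ c := by nlinarith
  refine ⟨fun x => ((1 - ε) * ((|P x - Q x| + (Q x - P x)) / 2) + c * P x) / ε,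
    fun x => ((1 - ε) * ((|P x - Q x| + (P x - Q x)) / 2) + c * P x) / ε,
    ⟨fun x => ?_, ?_⟩, ⟨fun x => ?_, ?_⟩, fun x => ?_⟩
  · have h1 := le_abs_self (P x - Q x)
    have := hP.1 x
    have : 0 ≤ (|P x - Q x| + (Q x - P x)) / 2 := by linarith
    have : 0 ≤ 1 - ε := by linarith
    positivity
  · rw [← Finset.sum_div, Finset.sum_add_distrib, ← Finset.mul_sum, ← Finset.mul_sum,
      ← Finset.sum_div, Finset.sum_add_distrib, Finset.sum_sub_distrib, hP.2, hQ.2, hTsum,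
      div_eq_one_iff_eq hε0.ne', hc]
    ring
  · have h1 := neg_abs_le (P x - Q x)
    have := hP.1 x
    have : 0 ≤ (|P x - Q x| + (P x - Q x)) / 2 := by linarith
    have : 0 ≤ 1 - ε := by linarith
    positivity
  · rw [← Finset.sum_div, Finset.sum_add_distrib, ← Finset.mul_sum, ← Finset.mul_sum,
      ← Finset.sum_div, Finset.sum_add_distrib, Finset.sum_sub_distrib, hP.2, hQ.2, hTsum,
      div_eq_one_iff_eq hε0.ne', hc]
    ring
  · field_simp
    ring

lemma IsDist.pi {α : Type*} [Fintype α] {p : α → ℝ} (hp : IsDist p) (k : ℕ) :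
    IsDist fun x : Fin k → α => ∏ i, p (x i) :=
  ⟨fun _ => Finset.prod_nonneg fun _ _ => hp.1 _, by rw [← Fintype.sum_pow, hp.2, one_pow]⟩

/-- The distribution on `Bool` with bias `t`, giving `true` the mass `1 / 2 + t`. -/
noncomputable def biasedCoin (t : ℝ) (b : Bool) : ℝ := if b then 1 / 2 + t else 1 / 2 - t

lemma isDist_biasedCoin {t : ℝ} (ht : |t| ≤ 1 / 2) : IsDist (biasedCoin t) := by
  obtain ⟨h1, h2⟩ := abs_le.1 ht
  refine ⟨fun b => ?_, ?_⟩
  · cases b <;> simp only [biasedCoin] <;> norm_num <;> linarith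
  · simp [biasedCoin]
    ring

lemma sum_abs_biasedCoin_sub (s t : ℝ) :
    ∑ b, |biasedCoin s b - biasedCoin t b| = 2 * |s - t| := by
  have h1 : 1 / 2 + s - (1 / 2 + t) = s - t := by ring
  have h2 : 1 / 2 - s - (1 / 2 - t) = -(s - t) := by ring
  simp only [Fintype.sum_bool, biasedCoin, if_true, Bool.false_eq_true, if_false, h1, h2, abs_neg]
  ring

lemma sum_prod_biasedCoin_mul (k : ℕ) (s t : ℝ) :
    ∑ x : Fin k → Bool, (∏ i, biasedCoin s (x i)) * ∏ i, biasedCoin t (x i) =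
      (1 / 2 + 2 * s * t) ^ k := by
  simp_rw [← Finset.prod_mul_distrib]
  rw [← Fintype.sum_pow fun b => biasedCoin s b * biasedCoin t b]
  congr 1
  simp [biasedCoin]
  ring

lemma sq_TV_prod_biasedCoin_le (k : ℕ) (s : ℝ) :
    TV (fun x : Fin k → Bool => ∏ i, biasedCoin s (x i)) (fun x => ∏ i, biasedCoin (-s) (x i)) ^ 2
      ≤ ((1 + 4 * s ^ 2) ^ k - (1 - 4 * s ^ 2) ^ k) / 2 := by
  have hcs := sq_sum_le_card_mul_sum_sq (s := (Finset.univ : Finset (Fin k → Bool)))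
    (f := fun x => |∏ i, biasedCoin s (x i) - ∏ i, biasedCoin (-s) (x i)|)
  have hsq : ∑ x : Fin k → Bool, |∏ i, biasedCoin s (x i) - ∏ i, biasedCoin (-s) (x i)| ^ 2 =
      2 * ((1 / 2 + 2 * s * s) ^ k - (1 / 2 + 2 * s * (-s)) ^ k) := by
    have h3 := sum_prod_biasedCoin_mul k (-s) (-s)
    rw [show 1 / 2 + 2 * -s * -s = 1 / 2 + 2 * s * s by ring] at h3
    have h1 := sum_prod_biasedCoin_mul k s s
    have h2 := sum_prod_biasedCoin_mul k s (-s)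
    rw [mul_sub, ← h2, two_mul]
    nth_rewrite 2 [← h3]
    rw [← h1, Finset.mul_sum, ← Finset.sum_add_distrib, ← Finset.sum_sub_distrib]
    refine Finset.sum_congr rfl fun x _ => ?_
    rw [sq_abs]
    ring
  rw [hsq] at hcs
  simp only [Finset.card_univ, Fintype.card_fun, Fintype.card_bool, Fintype.card_fin,
    Nat.cast_pow, Nat.cast_ofNat] at hcs
  have hr : (2 : ℝ) ^ k * (2 * ((1 / 2 + 2 * s * s) ^ k - (1 / 2 + 2 * s * (-s)) ^ k)) =
      2 * ((1 + 4 * s ^ 2) ^ k - (1 - 4 * s ^ 2) ^ k) := by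
    rw [mul_left_comm, mul_sub, ← mul_pow, ← mul_pow]
    ring_nf
  rw [hr] at hcs
  unfold TV
  rw [mul_pow]
  linarith

lemma one_add_pow_le_one_add_two_mul {y : ℝ} {k : ℕ} (hy : 0 ≤ y) (h : k * y ≤ 1 / 2) :
    (1 + y) ^ k ≤ 1 + 2 * (k * y) := by
  have h0 : 0 ≤ k * y := by positivity
  calc (1 + y) ^ k ≤ Real.exp y ^ k := by
        gcongr
        linarith [Real.add_one_le_exp y]
    _ = Real.exp (k * y) := (Real.exp_nat_mul y k).symm
    _ ≤ 1 / (1 - k * y) := Real.exp_bound_div_one_sub_of_interval h0 (by linarith)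
    _ ≤ 1 + 2 * (k * y) := by
        rw [div_le_iff₀ (by linarith)]
        nlinarith

lemma TV_prod_biasedCoin_le {k : ℕ} (hk : 1 ≤ k) {ε : ℝ} (hε0 : 0 ≤ ε) (hε1 : ε ≤ 1) {s : ℝ}
    (hs : k * (4 * s ^ 2) = ε ^ 2 / 2) :
    TV (fun x : Fin k → Bool => ∏ i, biasedCoin s (x i)) (fun x => ∏ i, biasedCoin (-s) (x i))
      ≤ ε := by
  have hk' : (1 : ℝ) ≤ k := by exact_mod_cast hk
  have hy : 4 * s ^ 2 ≤ 1 / 2 := by nlinarith [sq_nonneg s]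
  have h1 := one_add_pow_le_one_add_two_mul (y := 4 * s ^ 2) (k := k) (by positivity)
    (by nlinarith)
  have h2 := one_add_mul_le_pow (a := -(4 * s ^ 2)) (by linarith) k
  rw [← sub_eq_add_neg, mul_neg] at h2
  have h3 := sq_TV_prod_biasedCoin_le k s
  refine abs_le_of_sq_le_sq' ?_ hε0 |>.2
  nlinarith

/-- no estimator that sees only the ε-corrupted mixture of k-fold
product samples can recover `p` to ℓ₁ error better than `2η + ε/√(2k)`. -/
theorem stmt_0 (k : ℕ) (hk : 1 ≤ k) (ε η : ℝ)
    (hε : ε ∈ Set.Ioo (0 : ℝ) (1 / 2)) (hη : η ∈ Set.Ico (0 : ℝ) (1 / 4))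
    (f : ((Fin k → Bool) → ℝ) → (Bool → ℝ))
    (hf : ∀ P : (Fin k → Bool) → ℝ, IsDist P → IsDist (f P)) :
    ∃ p p' : Bool → ℝ, ∃ N : (Fin k → Bool) → ℝ,
      IsDist p ∧ IsDist p' ∧ IsDist N ∧ TV p p' ≤ η ∧
      ∑ b, |p b - f (fun x => (1 - ε) * ∏ i, p' (x i) + ε * N x) b|
        ≥ 2 * η + ε / Real.sqrt (2 * k) := by
  obtain ⟨hε0, hε1⟩ := hε
  obtain ⟨hη0, hη1⟩ := hη
  have hk' : (1 : ℝ) ≤ k := by exact_mod_cast hk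
  have hr1 : 1 ≤ Real.sqrt (2 * k) := Real.one_le_sqrt.2 (by linarith)
  obtain ⟨s, hs⟩ : ∃ s, s = ε / Real.sqrt (2 * k) / 2 := ⟨_, rfl⟩
  have hs0 : 0 ≤ s := by rw [hs]; positivity
  have hs1 : s ≤ 1 / 4 := by
    have : ε / Real.sqrt (2 * k) ≤ ε := div_le_self hε0.le hr1
    linarith
  have hsq : k * (4 * s ^ 2) = ε ^ 2 / 2 := by
    rw [hs, div_pow, div_pow, Real.sq_sqrt (by positivity)]
    field_simp
    norm_num
  have hds : IsDist (biasedCoin s) := isDist_biasedCoin (abs_le.2 ⟨by linarith, by linarith⟩)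
  have hdn : IsDist (biasedCoin (-s)) := isDist_biasedCoin (abs_le.2 ⟨by linarith, by linarith⟩)
  obtain ⟨N₁, N₂, hN₁, hN₂, hN⟩ := exists_contamination_eq (hds.pi k) (hdn.pi k) hε0
    (by linarith) (TV_prod_biasedCoin_le hk hε0.le (by linarith) hsq)
  have hf_eq : f (fun x => (1 - ε) * ∏ i, biasedCoin s (x i) + ε * N₁ x) =
      f (fun x => (1 - ε) * ∏ i, biasedCoin (-s) (x i) + ε * N₂ x) := congrArg f (funext hN)
  have hgap : ε / Real.sqrt (2 * k) = 2 * s := by rw [hs]; ring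
  rw [hgap]
  set q := f (fun x => (1 - ε) * ∏ i, biasedCoin s (x i) + ε * N₁ x)
  have htri : 4 * (s + η) ≤ ∑ b, |biasedCoin (s + η) b - q b| +
      ∑ b, |biasedCoin (-(s + η)) b - q b| := by
    have h := sum_abs_biasedCoin_sub (s + η) (-(s + η))
    rw [abs_of_nonneg (by linarith)] at h
    rw [← Finset.sum_add_distrib]
    calc 4 * (s + η) = _ := by rw [show 4 * (s + η) = 2 * (s + η - -(s + η)) by ring, ← h]
      _ ≤ _ := Finset.sum_le_sum fun b _ => by
        rw [abs_sub_comm (biasedCoin (-(s + η)) b)]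
        exact abs_sub_le _ _ _
  rcases le_total (2 * η + 2 * s) (∑ b, |biasedCoin (s + η) b - q b|) with h | h
  · refine ⟨biasedCoin (s + η), biasedCoin s, N₁,
      isDist_biasedCoin (abs_le.2 ⟨by linarith, by linarith⟩), hds, hN₁, ?_, h⟩
    rw [TV, sum_abs_biasedCoin_sub, add_sub_cancel_left, abs_of_nonneg hη0]
    linarith
  · refine ⟨biasedCoin (-(s + η)), biasedCoin (-s), N₂,
      isDist_biasedCoin (abs_le.2 ⟨by linarith, by linarith⟩), hdn, hN₂, ?_, ?_⟩
    · rw [TV, sum_abs_biasedCoin_sub, show -(s + η) - -s = -η by ring, abs_neg,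
        abs_of_nonneg hη0]
      linarith
    · rw [← hf_eq]
      linarith
end

section
/- For any ε ∈ (0, 1/2) and integer k ≥ 1, the Bernoulli distributions P and Q with means (1−ε)/2 and (1+ε)/2 satisfy: (1) Δ(P, Q) = ε, and (2) Δ(P^⊗k, Q^⊗k) ≤ ε·√(2k). -/
open Finset

/-- Bernoulli distribution on `{0,1}` (encoded as `Bool`) with mean `θ`. -/
def bern (θ : ℝ) : Bool → ℝ := fun b => if b then θ else 1 - θ

/-- The `k`-fold product distribution of `p`. -/
def prodDist {α : Type*} (k : ℕ) (p : α → ℝ) : (Fin k → α) → ℝ :=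
  fun x => ∏ i, p (x i)

/-- Le Cam's inequality between total variation and the Bhattacharyya coefficient. -/
theorem TV_sq_le_one_sub_sq_bhattacharyya {α : Type*} [Fintype α] {p q : α → ℝ}
    (hp : ∀ x, 0 ≤ p x) (hq : ∀ x, 0 ≤ q x) (hp1 : ∑ x, p x = 1) (hq1 : ∑ x, q x = 1) :
    TV p q ^ 2 ≤ 1 - (∑ x, √(p x * q x)) ^ 2 := by
  have hcs := sum_mul_sq_le_sq_mul_sq univ
    (fun x => |√(p x) - √(q x)|) (fun x => √(p x) + √(q x))
  have habs : ∀ x, |√(p x) - √(q x)| * (√(p x) + √(q x)) = |p x - q x| := by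
    intro x
    have hadd : 0 ≤ √(p x) + √(q x) := by positivity
    rw [← abs_of_nonneg hadd, ← abs_mul]
    congr 1
    linear_combination Real.sq_sqrt (hp x) - Real.sq_sqrt (hq x)
  have hsub : ∑ x, |√(p x) - √(q x)| ^ 2 = 2 - 2 * ∑ x, √(p x * q x) := by
    calc _ = ∑ x, (p x + q x - 2 * √(p x * q x)) := by
          refine sum_congr rfl fun x _ => ?_
          rw [sq_abs, Real.sqrt_mul (hp x)]
          linear_combination Real.sq_sqrt (hp x) + Real.sq_sqrt (hq x)
      _ = _ := by
          rw [sum_sub_distrib, sum_add_distrib, ← mul_sum, hp1, hq1]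
          ring
  have hadd : ∑ x, (√(p x) + √(q x)) ^ 2 = 2 + 2 * ∑ x, √(p x * q x) := by
    calc _ = ∑ x, (p x + q x + 2 * √(p x * q x)) := by
          refine sum_congr rfl fun x _ => ?_
          rw [Real.sqrt_mul (hp x)]
          linear_combination Real.sq_sqrt (hp x) + Real.sq_sqrt (hq x)
      _ = _ := by
          rw [sum_add_distrib, sum_add_distrib, ← mul_sum, hp1, hq1]
          ring
  simp only [habs, hsub, hadd] at hcs
  unfold TV
  linarith

theorem sum_prodDist {α : Type*} [Fintype α] (k : ℕ) (p : α → ℝ) :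
    ∑ x, prodDist k p x = (∑ a, p a) ^ k :=
  (Fintype.sum_pow p k).symm

theorem prodDist_nonneg {α : Type*} (k : ℕ) {p : α → ℝ} (hp : ∀ a, 0 ≤ p a)
    (x : Fin k → α) : 0 ≤ prodDist k p x :=
  prod_nonneg fun i _ => hp (x i)

theorem sqrt_prodDist_mul_prodDist {α : Type*} (k : ℕ) {p q : α → ℝ}
    (hp : ∀ a, 0 ≤ p a) (hq : ∀ a, 0 ≤ q a) (x : Fin k → α) :
    √(prodDist k p x * prodDist k q x) = prodDist k (fun a => √(p a * q a)) x := by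
  simp only [prodDist]
  rw [← prod_mul_distrib, Real.sqrt_prod _ fun i _ => mul_nonneg (hp _) (hq _)]

theorem bern_nonneg {θ : ℝ} (h0 : 0 ≤ θ) (h1 : θ ≤ 1) (b : Bool) : 0 ≤ bern θ b := by
  cases b <;> simp [bern, h0, h1]

theorem sum_bern (θ : ℝ) : ∑ b, bern θ b = 1 := by
  simp [bern]

theorem sq_sum_sqrt_bern_mul_bern {ε : ℝ} (h0 : 0 ≤ ε) (h1 : ε ≤ 1) :
    (∑ b, √(bern ((1 - ε) / 2) b * bern ((1 + ε) / 2) b)) ^ 2 = 1 - ε ^ 2 := by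
  have h : ∀ b, bern ((1 - ε) / 2) b * bern ((1 + ε) / 2) b = (1 - ε ^ 2) / 4 := by
    intro b
    cases b <;> simp [bern] <;> ring
  have hnonneg : 0 ≤ (1 - ε ^ 2) / 4 := by nlinarith
  simp only [h, Fintype.sum_bool]
  linear_combination 4 * Real.sq_sqrt hnonneg

/-- for Bernoulli distributions with means `(1−ε)/2` and `(1+ε)/2`,
`Δ(P,Q) = ε` and `Δ(P^⊗k, Q^⊗k) ≤ ε√(2k)`. -/
theorem stmt_2 (ε : ℝ) (hε : ε ∈ Set.Ioo (0 : ℝ) (1 / 2)) (k : ℕ) (hk : 1 ≤ k) :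
    TV (bern ((1 - ε) / 2)) (bern ((1 + ε) / 2)) = ε ∧
    TV (prodDist k (bern ((1 - ε) / 2))) (prodDist k (bern ((1 + ε) / 2)))
      ≤ ε * Real.sqrt (2 * k) := by
  obtain ⟨h0, h1⟩ := hε
  have hP := bern_nonneg (θ := (1 - ε) / 2) (by linarith) (by linarith)
  have hQ := bern_nonneg (θ := (1 + ε) / 2) (by linarith) (by linarith)
  constructor
  · have ht : (1 - ε) / 2 - (1 + ε) / 2 = -ε := by ring
    have hf : 1 - (1 - ε) / 2 - (1 - (1 + ε) / 2) = ε := by ring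
    simp only [TV, bern, Fintype.sum_bool, if_true, Bool.false_eq_true, if_false, ht, hf,
      abs_neg, abs_of_pos h0]
    ring
  · have hTV := TV_sq_le_one_sub_sq_bhattacharyya (prodDist_nonneg k hP) (prodDist_nonneg k hQ)
      (by rw [sum_prodDist, sum_bern, one_pow]) (by rw [sum_prodDist, sum_bern, one_pow])
    simp only [sqrt_prodDist_mul_prodDist k hP hQ, sum_prodDist] at hTV
    rw [pow_right_comm, sq_sum_sqrt_bern_mul_bern h0.le (by linarith)] at hTV
    have hbernoulli : 1 + (k : ℝ) * (-ε ^ 2) ≤ (1 + -ε ^ 2) ^ k :=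
      one_add_mul_le_pow (by nlinarith) k
    rw [← sub_eq_add_neg] at hbernoulli
    refine abs_le_of_sq_le_sq' ?_ (by positivity) |>.2
    rw [mul_pow, Real.sq_sqrt (by positivity)]
    nlinarith [mul_nonneg (Nat.cast_nonneg (α := ℝ) k) (sq_nonneg ε)]
end

section
/- Suppose k is a positive integer, ε ∈ (0, 1/(15√k)), and P and Q are two probability distributions on the same finite set such that Δ(P, Q) ≥ ε. Then Δ(P^⊗k, Q^⊗k) ≥ ε·√k / 15. -/
open Finset

lemma norm_pow_sub_pow_le_mul {a b : ℂ} (ha : ‖a‖ ≤ 1) (hb : ‖b‖ ≤ 1) (n : ℕ) :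
    ‖a ^ n - b ^ n‖ ≤ n * ‖a - b‖ := by
  induction n with
  | zero => simp
  | succ n ih =>
    have h : a ^ (n + 1) - b ^ (n + 1) = a * (a ^ n - b ^ n) + b ^ n * (a - b) := by ring
    have h₁ : ‖a‖ * ‖a ^ n - b ^ n‖ ≤ 1 * (n * ‖a - b‖) :=
      mul_le_mul ha ih (norm_nonneg _) zero_le_one
    have h₂ : ‖b‖ ^ n * ‖a - b‖ ≤ 1 * ‖a - b‖ :=
      mul_le_mul_of_nonneg_right (pow_le_one₀ (norm_nonneg _) hb) (norm_nonneg _)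
    calc ‖a ^ (n + 1) - b ^ (n + 1)‖ ≤ ‖a‖ * ‖a ^ n - b ^ n‖ + ‖b‖ ^ n * ‖a - b‖ := by
          rw [h, ← norm_pow, ← norm_mul, ← norm_mul]
          exact norm_add_le _ _
      _ ≤ (n + 1 : ℕ) * ‖a - b‖ := by push_cast; linarith

/-- First-order Taylor estimate for powers on the closed unit disc. -/
lemma norm_pow_succ_sub_linear_le {a b : ℂ} (ha : ‖a‖ ≤ 1) (hb : ‖b‖ ≤ 1) (n : ℕ) :
    ‖a ^ (n + 1) - b ^ (n + 1) - (n + 1) * b ^ n * (a - b)‖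
      ≤ n * (n + 1) / 2 * ‖a - b‖ ^ 2 := by
  induction n with
  | zero => simp
  | succ n ih =>
    have h : a ^ (n + 1 + 1) - b ^ (n + 1 + 1) - ((n + 1 : ℕ) + 1) * b ^ (n + 1) * (a - b)
        = b * (a ^ (n + 1) - b ^ (n + 1) - (n + 1) * b ^ n * (a - b))
          + (a - b) * (a ^ (n + 1) - b ^ (n + 1)) := by push_cast; ring
    have h₁ := mul_le_mul hb ih (norm_nonneg _) zero_le_one
    have h₂ := mul_le_mul_of_nonneg_left (norm_pow_sub_pow_le_mul ha hb (n + 1))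
      (norm_nonneg (a - b))
    rw [h]
    refine (norm_add_le _ _).trans ?_
    rw [norm_mul, norm_mul]
    push_cast at h₂ ⊢
    nlinarith

lemma exists_norm_one_add_eq_one {r : ℝ} (h0 : 0 ≤ r) (h2 : r ≤ 2) :
    ∃ w : ℂ, ‖w‖ = r ∧ 2 * w.re = -r ^ 2 := by
  have hs : 0 ≤ 1 - r ^ 2 / 4 := by nlinarith
  refine ⟨⟨-r ^ 2 / 2, r * √(1 - r ^ 2 / 4)⟩, ?_, by simp; ring⟩
  rw [← sq_eq_sq₀ (norm_nonneg _) h0, Complex.sq_norm, Complex.normSq_mk]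
  have := Real.mul_self_sqrt hs
  linear_combination r ^ 2 * this

lemma sq_norm_one_add_ofReal_mul {w : ℂ} (hw : 2 * w.re = -‖w‖ ^ 2) (p : ℝ) :
    ‖1 + p * w‖ ^ 2 = 1 - p * (1 - p) * ‖w‖ ^ 2 := by
  have h := Complex.sq_norm w
  rw [Complex.normSq_apply] at h
  rw [Complex.sq_norm, Complex.normSq_apply]
  simp only [Complex.add_re, Complex.add_im, Complex.mul_re, Complex.mul_im, Complex.one_re,
    Complex.one_im, Complex.ofReal_re, Complex.ofReal_im]
  linear_combination p * hw - p ^ 2 * h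

lemma norm_one_add_ofReal_mul_le_one {w : ℂ} (hw : 2 * w.re = -‖w‖ ^ 2) {p : ℝ}
    (h0 : 0 ≤ p) (h1 : p ≤ 1) : ‖1 + p * w‖ ≤ 1 := by
  have h := sq_norm_one_add_ofReal_mul hw p
  have : 0 ≤ p * (1 - p) * ‖w‖ ^ 2 := by
    have := sub_nonneg.2 h1
    positivity
  exact (sq_le_one_iff₀ (norm_nonneg _)).1 (by linarith)

/-- The characteristic functions of two binomial distributions of size `n + 1` differ by
at least a quarter of the difference of the means times the frequency. -/
lemma le_norm_pow_sub_pow {w : ℂ} (hw : 2 * w.re = -‖w‖ ^ 2) {p q : ℝ}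
    (hp0 : 0 ≤ p) (hp1 : p ≤ 1) (hq0 : 0 ≤ q) (hq1 : q ≤ 1) (hpq : q ≤ p) (n : ℕ)
    (hr : (n + 1) * ‖w‖ ^ 2 ≤ 1) (hd : (n + 1) * (p - q) * ‖w‖ ≤ 1) :
    (n + 1) * (p - q) * ‖w‖ / 4 ≤ ‖(1 + p * w) ^ (n + 1) - (1 + q * w) ^ (n + 1)‖ := by
  have ha := norm_one_add_ofReal_mul_le_one hw hp0 hp1
  have hb := norm_one_add_ofReal_mul_le_one hw hq0 hq1
  have hbsq := sq_norm_one_add_ofReal_mul hw q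
  have hn : (0 : ℝ) ≤ n := n.cast_nonneg
  have hr0 := norm_nonneg w
  have hw1 : ‖w‖ ^ 2 ≤ 1 := by nlinarith [sq_nonneg ‖w‖]
  have hb' : 1 + (-(‖w‖ ^ 2 / 4)) ≤ ‖1 + q * w‖ := by
    nlinarith [norm_nonneg (1 + q * w), mul_nonneg (sq_nonneg (2 * q - 1)) (sq_nonneg ‖w‖)]
  have hbn : 1 - n * ‖w‖ ^ 2 / 4 ≤ ‖1 + q * w‖ ^ n := by
    have h₁ := one_add_mul_le_pow (a := -(‖w‖ ^ 2 / 4)) (by linarith) n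
    have h₂ := pow_le_pow_left₀ (by linarith) hb' n
    linarith
  have hab : ‖(1 + p * w) - (1 + q * w)‖ = (p - q) * ‖w‖ := by
    rw [show (1 + p * w) - (1 + q * w) = ((p - q : ℝ) : ℂ) * w by push_cast; ring, norm_mul,
      Complex.norm_of_nonneg (sub_nonneg.2 hpq)]
  have ht := norm_pow_succ_sub_linear_le ha hb n
  have hl : ‖((n : ℂ) + 1) * (1 + q * w) ^ n * ((1 + p * w) - (1 + q * w))‖
      = (n + 1) * ‖1 + q * w‖ ^ n * ((p - q) * ‖w‖) := by
    rw [norm_mul, norm_mul, norm_pow, hab]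
    congr 2
    exact_mod_cast Complex.norm_natCast (n + 1)
  have htri := norm_sub_norm_le
    (((n : ℂ) + 1) * (1 + q * w) ^ n * ((1 + p * w) - (1 + q * w)))
    ((1 + p * w) ^ (n + 1) - (1 + q * w) ^ (n + 1))
  rw [hl, norm_sub_rev (_ * _)] at htri
  rw [hab] at ht
  set d := (p - q) * ‖w‖ with hd_def
  have hd0 : 0 ≤ d := mul_nonneg (sub_nonneg.2 hpq) hr0
  rw [mul_assoc, ← hd_def] at hd ⊢
  have h₁ : (n + 1) * d * (3 / 4) ≤ (n + 1) * d * ‖1 + q * w‖ ^ n := by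
    apply mul_le_mul_of_nonneg_left _ (by positivity)
    nlinarith [sq_nonneg ‖w‖]
  have h₂ : n * (n + 1) / 2 * d ^ 2 ≤ (n + 1) * d / 2 := by
    have : (n + 1) * d * (n * d) ≤ (n + 1) * d * 1 := by
      apply mul_le_mul_of_nonneg_left _ (by positivity)
      linarith
    linarith
  linarith

/-- Total variation distance dominates differences of expectations of bounded functions. -/
lemma norm_sum_sub_sum_le_TV {α : Type*} [Fintype α] (P Q : α → ℝ) {u : α → ℂ}
    (hu : ∀ x, ‖u x‖ ≤ 1) : ‖∑ x, P x * u x - ∑ x, Q x * u x‖ ≤ 2 * TV P Q := by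
  rw [← sum_sub_distrib, TV, ← mul_assoc, mul_one_div_cancel two_ne_zero, one_mul]
  refine norm_sum_le_of_le _ fun x _ => ?_
  rw [← sub_mul, ← Complex.ofReal_sub, norm_mul, Complex.norm_real, Real.norm_eq_abs]
  exact mul_le_of_le_one_right (abs_nonneg _) (hu x)

lemma sum_prodDist_mul_prod {α : Type*} [Fintype α] (k : ℕ) (P : α → ℝ) (u : α → ℂ) :
    ∑ x, (prodDist k P x : ℂ) * ∏ i, u (x i) = (∑ a, P a * u a) ^ k := by
  classical
  rw [Fintype.sum_pow]
  simp [prodDist, prod_mul_distrib]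

/-- Total variation distance is attained on the event `Q < P`. -/
lemma TV_eq_sum_filter {α : Type*} [Fintype α] {P Q : α → ℝ} (hP : IsDist P) (hQ : IsDist Q) :
    TV P Q = ∑ x with Q x < P x, P x - ∑ x with Q x < P x, Q x := by
  have h : ∑ x, (P x - Q x) = 0 := by rw [sum_sub_distrib, hP.2, hQ.2, sub_self]
  have h' : ∑ x, |P x - Q x| = ∑ x, (2 * (if Q x < P x then P x - Q x else 0) - (P x - Q x)) := by
    refine sum_congr rfl fun x _ => ?_
    split_ifs with hx
    · rw [abs_of_pos (sub_pos.2 hx)]; ring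
    · rw [abs_of_nonpos (sub_nonpos.2 (not_lt.1 hx))]; ring
  rw [TV, h', sum_sub_distrib, h, ← mul_sum, ← sum_filter, sum_sub_distrib]
  ring

lemma IsDist.sum_mul_one_add_ite {α : Type*} [Fintype α] {P : α → ℝ} (hP : IsDist P)
    (s : α → Prop) [DecidablePred s] (w : ℂ) :
    ∑ x, (P x : ℂ) * (if s x then 1 + w else 1) = 1 + ((∑ x with s x, P x : ℝ) : ℂ) * w := by
  have h : ∀ x, (P x : ℂ) * (if s x then 1 + w else 1)
      = P x + (if s x then (P x : ℂ) else 0) * w := by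
    intro x; split_ifs <;> ring
  simp_rw [h]
  rw [sum_add_distrib, ← sum_mul, ← sum_filter, ← Complex.ofReal_sum, hP.2]
  push_cast
  rfl

lemma IsDist.sum_filter_le_one {α : Type*} [Fintype α] {P : α → ℝ} (hP : IsDist P)
    (s : α → Prop) [DecidablePred s] : ∑ x with s x, P x ≤ 1 :=
  hP.2 ▸ sum_le_sum_of_subset_of_nonneg (filter_subset _ _) fun x _ _ => hP.1 x

lemma le_TV_prodDist {α : Type*} [Fintype α] {P Q : α → ℝ} (hP : IsDist P) (hQ : IsDist Q)
    (n : ℕ) {r : ℝ} (hr0 : 0 ≤ r) (hr : (n + 1) * r ^ 2 ≤ 1) (hd : (n + 1) * TV P Q * r ≤ 1) :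
    (n + 1) * TV P Q * r / 8 ≤ TV (prodDist (n + 1) P) (prodDist (n + 1) Q) := by
  have hn : (0 : ℝ) ≤ n := n.cast_nonneg
  obtain ⟨w, rfl, hw⟩ := exists_norm_one_add_eq_one hr0 (by nlinarith)
  have hTV0 : 0 ≤ TV P Q := by unfold TV; positivity
  have hTV := TV_eq_sum_filter hP hQ
  have hunit : ∀ x, ‖if Q x < P x then 1 + w else 1‖ ≤ 1 := by
    intro x
    split_ifs
    · simpa using norm_one_add_ofReal_mul_le_one hw zero_le_one le_rfl
    · simp
  have h := norm_sum_sub_sum_le_TV (prodDist (n + 1) P) (prodDist (n + 1) Q)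
    (u := fun x => ∏ i, if Q (x i) < P (x i) then 1 + w else 1)
    fun x => by
      rw [norm_prod]
      exact prod_le_one (fun _ _ => norm_nonneg _) fun i _ => hunit (x i)
  rw [sum_prodDist_mul_prod _ P fun x => if Q x < P x then 1 + w else 1,
    sum_prodDist_mul_prod _ Q fun x => if Q x < P x then 1 + w else 1,
    hP.sum_mul_one_add_ite (fun x => Q x < P x), hQ.sum_mul_one_add_ite (fun x => Q x < P x)] at h
  have h' := le_norm_pow_sub_pow hw (sum_nonneg fun x _ => hP.1 x)
    (hP.sum_filter_le_one fun x => Q x < P x) (sum_nonneg fun x _ => hQ.1 x)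
    (hQ.sum_filter_le_one fun x => Q x < P x) (by linarith) n hr (by rwa [← hTV])
  rw [← hTV] at h'
  linarith

/-- if `Δ(P,Q) ≥ ε` with `ε < 1/(15√k)`, then
`Δ(P^⊗k, Q^⊗k) ≥ ε√k/15`. -/
theorem stmt_3 {α : Type*} [Fintype α] (k : ℕ) (hk : 0 < k) (ε : ℝ)
    (hε : 0 < ε) (hε' : ε < 1 / (15 * Real.sqrt k))
    (P Q : α → ℝ) (hP : IsDist P) (hQ : IsDist Q) (hPQ : TV P Q ≥ ε) :
    TV (prodDist k P) (prodDist k Q) ≥ ε * Real.sqrt k / 15 := by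
  obtain ⟨n, rfl⟩ := Nat.exists_eq_succ_of_ne_zero hk.ne'
  have hδ : 0 < TV P Q := hε.trans_le hPQ
  have hs : 0 < √((n + 1 : ℕ) : ℝ) := Real.sqrt_pos.2 (by positivity)
  have hss : √((n + 1 : ℕ) : ℝ) ^ 2 = n + 1 := by
    rw [Real.sq_sqrt (by positivity)]; push_cast; rfl
  change ε < 1 / (15 * √((n + 1 : ℕ) : ℝ)) at hε'
  change ε * √((n + 1 : ℕ) : ℝ) / 15 ≤ TV (prodDist (n + 1) P) (prodDist (n + 1) Q)
  set s := √((n + 1 : ℕ) : ℝ)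
  rw [lt_div_iff₀ (by positivity)] at hε'
  rcases le_total (TV P Q * s) 1 with h | h
  · have h₁ := le_TV_prodDist hP hQ n (r := 1 / s) (by positivity)
      (by rw [← hss]; field_simp; rfl)
      (by rw [← hss]; field_simp; linarith)
    have h₂ : (n + 1) * TV P Q * (1 / s) = TV P Q * s := by rw [← hss]; field_simp
    nlinarith
  · have h₁ := le_TV_prodDist hP hQ n (r := 1 / (s ^ 2 * TV P Q)) (by positivity)
      (by rw [← hss]; field_simp; nlinarith)
      (by rw [← hss]; field_simp; rfl)
    have h₂ : (n + 1) * TV P Q * (1 / (s ^ 2 * TV P Q)) = 1 := by rw [← hss]; field_simp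
    rw [h₂] at h₁
    linarith
end

section
/- Suppose k is a positive integer, ε ∈ (0, 1/(15√k)), p, q ∈ [0,1] with q − p ≥ ε. Let P̃ be any finite mixture of binomial distributions with k trials and success probabilities all lying in [0, p] (i.e., P̃ = Σᵢ αᵢ·B(k, pᵢ) with αᵢ ≥ 0, Σᵢ αᵢ = 1, pᵢ ∈ [0, p]), and let Q̃ be any finite mixture of binomial distributions with k trials and success probabilities all lying in [q, 1]. Then Δ(P̃, Q̃) ≥ ε·√k / 15. -/
open Finset

/-- Binomial distribution on `{0,1,…,k}` with `k` trials and success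
probability `θ`. -/
noncomputable def binom (k : ℕ) (θ : ℝ) : Fin (k + 1) → ℝ :=
  fun j => (k.choose j : ℝ) * θ ^ (j : ℕ) * (1 - θ) ^ (k - (j : ℕ))

open Polynomial in
/-- The polynomial in `θ` giving the expectation of `f` under the binomial distribution with `n`
trials and success probability `θ`. -/
noncomputable def binomExp (f : ℕ → ℝ) (n : ℕ) : ℝ[X] :=
  ∑ ν ∈ range (n + 1), C (f ν) * bernsteinPolynomial ℝ n ν

theorem bernsteinPolynomial_eval_nonneg (n ν : ℕ) {θ : ℝ} (hθ : θ ∈ Set.Icc (0 : ℝ) 1) :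
    0 ≤ (bernsteinPolynomial ℝ n ν).eval θ := by
  have h0 := hθ.1
  have h1 := sub_nonneg.2 hθ.2
  simp only [bernsteinPolynomial, Polynomial.eval_mul, Polynomial.eval_natCast,
    Polynomial.eval_pow, Polynomial.eval_X, Polynomial.eval_sub, Polynomial.eval_one]
  positivity

theorem sum_mul_binom (f : ℕ → ℝ) (n : ℕ) (θ : ℝ) :
    ∑ x : Fin (n + 1), f x * binom n θ x = (binomExp f n).eval θ := by
  rw [binomExp, Polynomial.eval_finsetSum, ← Fin.sum_univ_eq_sum_range
    (fun ν => (Polynomial.C (f ν) * bernsteinPolynomial ℝ n ν).eval θ)]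
  simp [binom, bernsteinPolynomial]

theorem eval_binomExp (f : ℕ → ℝ) (n : ℕ) (θ : ℝ) :
    (binomExp f n).eval θ = ∑ ν ∈ range (n + 1), f ν * (bernsteinPolynomial ℝ n ν).eval θ := by
  simp [binomExp, Polynomial.eval_finsetSum]

theorem derivative_binomExp (f : ℕ → ℝ) (n : ℕ) :
    Polynomial.derivative (binomExp f (n + 1)) =
      ((n : Polynomial ℝ) + 1) * binomExp (fun ν => f (ν + 1) - f ν) n := by
  have hshift : ∑ ν ∈ range (n + 1), Polynomial.C (f ν) * bernsteinPolynomial ℝ n ν =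
      ∑ ν ∈ range (n + 1), Polynomial.C (f (ν + 1)) * bernsteinPolynomial ℝ n (ν + 1) +
        Polynomial.C (f 0) * bernsteinPolynomial ℝ n 0 := by
    rw [← sum_range_succ' (fun ν => Polynomial.C (f ν) * bernsteinPolynomial ℝ n ν),
      sum_range_succ _ (n + 1), bernsteinPolynomial.eq_zero_of_lt ℝ (Nat.lt_succ_self n)]
    simp
  simp only [binomExp, Polynomial.derivative_sum, Polynomial.derivative_C_mul,
    Polynomial.C_sub, sub_mul, sum_sub_distrib, hshift]
  rw [sum_range_succ', bernsteinPolynomial.derivative_zero]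
  simp only [bernsteinPolynomial.derivative_succ_aux, mul_sub, mul_left_comm (Polynomial.C _),
    sum_sub_distrib, ← mul_sum, Nat.cast_add, Nat.cast_one, Nat.add_sub_cancel]
  ring

theorem deriv_binomExp (f : ℕ → ℝ) (n : ℕ) (θ : ℝ) :
    deriv (fun x => (binomExp f (n + 1)).eval x) θ =
      (n + 1) * ∑ ν ∈ range (n + 1), (f (ν + 1) - f ν) * (bernsteinPolynomial ℝ n ν).eval θ := by
  rw [Polynomial.deriv, derivative_binomExp]
  simp [eval_binomExp]

theorem binomExp_monotoneOn {f : ℕ → ℝ} (hf : Monotone f) (n : ℕ) :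
    MonotoneOn (fun x => (binomExp f (n + 1)).eval x) (Set.Icc 0 1) := by
  refine monotoneOn_of_deriv_nonneg (convex_Icc _ _) (Polynomial.continuousOn _)
    (Polynomial.differentiableOn _) fun θ hθ => ?_
  rw [deriv_binomExp]
  exact mul_nonneg (by positivity) (sum_nonneg fun ν _ => mul_nonneg
    (sub_nonneg.2 (hf ν.le_succ)) (bernsteinPolynomial_eval_nonneg n ν (interior_subset hθ)))

theorem sum_sq_mul_bernsteinPolynomial_eval (n : ℕ) (θ : ℝ) :
    ∑ ν ∈ range (n + 1), ((ν : ℝ) - n * θ) ^ 2 * (bernsteinPolynomial ℝ n ν).eval θ =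
      n * θ * (1 - θ) := by
  have h := congrArg (Polynomial.eval θ) (bernsteinPolynomial.variance ℝ n)
  simp only [Polynomial.eval_finsetSum, Polynomial.eval_mul, Polynomial.eval_pow,
    Polynomial.eval_sub, nsmul_eq_mul, Polynomial.eval_natCast, Polynomial.eval_X,
    Polynomial.eval_one] at h
  simpa only [sub_sq_comm] using h

/-- The affine function of slope `1 / (6 * s)` vanishing at `c`, truncated to
`[-1 / 2, 1 / 2]`. -/
noncomputable def ramp (c s y : ℝ) : ℝ := max (-(1 / 2)) (min (1 / 2) ((y - c) / (6 * s)))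

theorem abs_ramp_le (c s y : ℝ) : |ramp c s y| ≤ 1 / 2 :=
  abs_le.2 ⟨le_max_left _ _, max_le (by norm_num) (min_le_left _ _)⟩

theorem ramp_mono (c : ℝ) {s : ℝ} (hs : 0 < s) : Monotone (ramp c s) := fun x y h => by
  unfold ramp
  gcongr

theorem ramp_eq {c s y : ℝ} (hs : 0 < s) (h₁ : -(3 * s) ≤ y - c) (h₂ : y - c ≤ 3 * s) :
    ramp c s y = (y - c) / (6 * s) := by
  have h : (y - c) / (6 * s) ≤ 1 / 2 := by
    rw [div_le_iff₀ (by positivity)]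
    linarith
  have h' : -(1 / 2) ≤ (y - c) / (6 * s) := by
    rw [le_div_iff₀ (by positivity)]
    linarith
  rw [ramp, min_eq_right h, max_eq_right h']

theorem le_ramp_succ_sub {c s m : ℝ} (hs : 1 ≤ s) (h₁ : -1 ≤ m - c) (h₂ : m - c ≤ s) (y : ℝ) :
    1 / (6 * s) * (1 - (y - m) ^ 2 / s ^ 2) ≤ ramp c s (y + 1) - ramp c s y := by
  have hs0 : 0 < s := by linarith
  rcases le_or_gt s |y - m| with h | h
  · have h3 : 1 ≤ (y - m) ^ 2 / s ^ 2 := by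
      rw [le_div_iff₀ (by positivity), one_mul]
      exact sq_le_sq.2 (by rwa [abs_of_pos hs0])
    calc _ ≤ (0 : ℝ) := mul_nonpos_of_nonneg_of_nonpos (by positivity) (by linarith)
      _ ≤ _ := sub_nonneg.2 (ramp_mono c hs0 (by linarith))
  · obtain ⟨h3, h4⟩ := abs_lt.1 h
    rw [ramp_eq hs0 (by linarith) (by linarith), ramp_eq hs0 (by linarith) (by linarith),
      ← sub_div, show y + 1 - c - (y - c) = 1 by ring]
    exact mul_le_of_le_one_right (by positivity) (sub_le_self _ (by positivity))

theorem le_deriv_binomExp_ramp {n : ℕ} {c s θ : ℝ} (hθ : θ ∈ Set.Icc (0 : ℝ) 1) (hs : 1 ≤ s)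
    (hsn : s ^ 2 = n + 1) (h₁ : -1 ≤ n * θ - c) (h₂ : n * θ - c ≤ s) :
    s / 8 ≤ deriv (fun x => (binomExp (fun ν => ramp c s ν) (n + 1)).eval x) θ := by
  have hs0 : 0 < s := by linarith
  have hsum : ∑ ν ∈ range (n + 1), (bernsteinPolynomial ℝ n ν).eval θ = 1 := by
    rw [← Polynomial.eval_finsetSum, bernsteinPolynomial.sum, Polynomial.eval_one]
  have hvar : (n * θ * (1 - θ)) / s ^ 2 ≤ 1 / 4 := by
    rw [div_le_iff₀ (by positivity), hsn]
    nlinarith [mul_nonneg n.cast_nonneg (sq_nonneg (θ - 1 / 2))]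
  rw [deriv_binomExp, ← hsn]
  calc s / 8 = s ^ 2 * (1 / (6 * s) * (1 - 1 / 4)) := by field_simp; norm_num
    _ ≤ s ^ 2 * (1 / (6 * s) * (1 - (n * θ * (1 - θ)) / s ^ 2)) := by gcongr
    _ = s ^ 2 * ∑ ν ∈ range (n + 1), (1 / (6 * s) * (1 - ((ν : ℝ) - n * θ) ^ 2 / s ^ 2)) *
          (bernsteinPolynomial ℝ n ν).eval θ := by
      simp only [sub_mul, one_mul, sum_sub_distrib, hsum,
        div_mul_eq_mul_div, ← sum_div]
      rw [sum_sq_mul_bernsteinPolynomial_eval]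
    _ ≤ _ := by
      gcongr with ν _
      · exact bernsteinPolynomial_eval_nonneg n ν hθ
      · push_cast
        exact le_ramp_succ_sub hs h₁ h₂ ν

theorem sum_mul_sub_le_TV {α : Type*} [Fintype α] {f : α → ℝ} (hf : ∀ x, |f x| ≤ 1 / 2)
    (P Q : α → ℝ) : ∑ x, f x * Q x - ∑ x, f x * P x ≤ TV P Q := by
  rw [TV, ← sum_sub_distrib, mul_sum]
  refine sum_le_sum fun x _ => ?_
  rw [← mul_sub, abs_sub_comm]
  exact (le_abs_self _).trans (by rw [abs_mul]; gcongr; exact hf x)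

theorem sum_mul_binom_mixture {ι : Type*} [Fintype ι] (f : ℕ → ℝ) (n : ℕ) (a θ : ι → ℝ) :
    ∑ x : Fin (n + 1), f x * ∑ i, a i * binom n (θ i) x =
      ∑ i, a i * (binomExp f n).eval (θ i) := by
  simp only [← sum_mul_binom, mul_sum]
  rw [sum_comm]
  exact sum_congr rfl fun i _ => sum_congr rfl fun x _ => mul_left_comm _ _ _

/-- two mixtures of binomial distributions whose success
probabilities lie in `[0,p]` and `[q,1]` respectively, with `q − p ≥ ε`, have
total variation distance at least `ε√k/15`. -/
theorem stmt_4 (k : ℕ) (hk : 0 < k) (ε p q : ℝ)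
    (hε : 0 < ε) (hε' : ε < 1 / (15 * Real.sqrt k))
    (hp : p ∈ Set.Icc (0 : ℝ) 1) (hq : q ∈ Set.Icc (0 : ℝ) 1) (hpq : q - p ≥ ε)
    (ι κ : Type*) [Fintype ι] [Fintype κ]
    (a : ι → ℝ) (ps : ι → ℝ) (b : κ → ℝ) (qs : κ → ℝ)
    (ha : ∀ i, 0 ≤ a i) (hasum : ∑ i, a i = 1)
    (hps : ∀ i, ps i ∈ Set.Icc (0 : ℝ) p)
    (hb : ∀ j, 0 ≤ b j) (hbsum : ∑ j, b j = 1)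
    (hqs : ∀ j, qs j ∈ Set.Icc q (1 : ℝ)) :
    TV (fun x => ∑ i, a i * binom k (ps i) x)
       (fun x => ∑ j, b j * binom k (qs j) x)
      ≥ ε * Real.sqrt k / 15 := by
  obtain ⟨n, rfl⟩ := Nat.exists_eq_add_one.2 hk
  have hsn : Real.sqrt (n + 1 : ℕ) ^ 2 = n + 1 := by
    rw [Real.sq_sqrt (Nat.cast_nonneg _)]
    push_cast
    rfl
  have hs : 1 ≤ Real.sqrt (n + 1 : ℕ) := Real.one_le_sqrt.2 (by simp)
  set s := Real.sqrt (n + 1 : ℕ)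
  have hεs : ε * (15 * s) < 1 := (lt_div_iff₀ (by positivity)).1 hε'
  have hsε : s ^ 2 * ε ≤ s := by nlinarith
  set f : ℕ → ℝ := fun ν => ramp ((n + 1) * p) s ν
  have hf : Monotone f := (ramp_mono _ (by linarith)).comp Nat.mono_cast
  have hmono := binomExp_monotoneOn hf n
  have hpε : p + ε ∈ Set.Icc (0 : ℝ) 1 := ⟨by linarith [hp.1], by linarith [hq.2]⟩
  have hsub : Set.Icc p (p + ε) ⊆ Set.Icc (0 : ℝ) 1 := Set.Icc_subset_Icc hp.1 hpε.2
  have hgap : s / 8 * (p + ε - p) ≤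
      (binomExp f (n + 1)).eval (p + ε) - (binomExp f (n + 1)).eval p := by
    refine (convex_Icc p (p + ε)).mul_sub_le_image_sub_of_le_deriv
      (f := fun x => (binomExp f (n + 1)).eval x) (Polynomial.continuousOn _)
      (Polynomial.differentiableOn _) (fun θ hθ => ?_) p
      (Set.left_mem_Icc.2 (by linarith)) (p + ε) (Set.right_mem_Icc.2 (by linarith)) (by linarith)
    have hθ' := interior_subset hθ
    have hθ01 := hsub hθ'
    have hle : s ^ 2 * (θ - p) ≤ s ^ 2 * ε := by
      gcongr
      linarith [hθ'.2]
    have hge : 0 ≤ s ^ 2 * (θ - p) := mul_nonneg (by positivity) (by linarith [hθ'.1])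
    rw [hsn] at hle hge hsε
    exact le_deriv_binomExp_ramp hθ01 hs hsn (by linarith [hθ01.2]) (by linarith [hθ01.1])
  have hP : ∑ i, a i * (binomExp f (n + 1)).eval (ps i) ≤ (binomExp f (n + 1)).eval p := by
    rw [← one_mul ((binomExp f (n + 1)).eval p), ← hasum, sum_mul]
    exact sum_le_sum fun i _ => mul_le_mul_of_nonneg_left
      (hmono ⟨(hps i).1, (hps i).2.trans hp.2⟩ hp (hps i).2) (ha i)
  have hQ : (binomExp f (n + 1)).eval (p + ε) ≤
      ∑ j, b j * (binomExp f (n + 1)).eval (qs j) := by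
    rw [← one_mul ((binomExp f (n + 1)).eval (p + ε)), ← hbsum, sum_mul]
    exact sum_le_sum fun j _ => mul_le_mul_of_nonneg_left
      (hmono hpε ⟨hq.1.trans (hqs j).1, (hqs j).2⟩ (by linarith [(hqs j).1])) (hb j)
  have hTV := sum_mul_sub_le_TV (f := fun x : Fin (n + 1 + 1) => f x)
    (fun x => abs_ramp_le _ _ _)
    (fun x => ∑ i, a i * binom (n + 1) (ps i) x) (fun x => ∑ j, b j * binom (n + 1) (qs j) x)
  rw [sum_mul_binom_mixture, sum_mul_binom_mixture] at hTV
  have hεs0 : 0 < ε * s := by positivity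
  linarith
end

section
/- Suppose n and m are positive integers with m ≥ max(n, 2). Then for any real α ∈ [0, 1.1·√n], it holds that (1 + α/n)^n · (1 − α/m)^m ≥ 1/7. -/
/-- For `x ≤ k`, the expression `(1 - x / k) ^ k` does not decrease when `k` grows. -/
theorem one_sub_div_pow_le_one_sub_div_pow {k m : ℕ} {x : ℝ} (hk : 0 < k) (hkm : k ≤ m)
    (hxk : x ≤ k) : (1 - x / k) ^ k ≤ (1 - x / m) ^ m := by
  have hk' : (0 : ℝ) < k := by exact_mod_cast hk
  have hkm' : (k : ℝ) ≤ m := by exact_mod_cast hkm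
  have hm' : (0 : ℝ) < m := hk'.trans_le hkm'
  have hxm : x / m ≤ 1 := (div_le_one hm').2 (hxk.trans hkm')
  have bernoulli := one_add_mul_self_le_rpow_one_add (s := -(x / m)) (by linarith)
    (p := (m : ℝ) / k) ((one_le_div hk').2 hkm')
  calc (1 - x / k) ^ k = (1 + (m : ℝ) / k * -(x / m)) ^ k := by
        congr 1
        field_simp
        ring
    _ ≤ ((1 + -(x / m)) ^ ((m : ℝ) / k)) ^ k := by
        refine pow_le_pow_left₀ ?_ bernoulli k
        have h : x / k ≤ 1 := (div_le_one hk').2 hxk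
        have h' : (m : ℝ) / k * -(x / m) = -(x / k) := by field_simp
        linarith
    _ = (1 - x / m) ^ m := by
        rw [← Real.rpow_mul_natCast (by linarith), div_mul_cancel₀ _ hk'.ne', Real.rpow_natCast,
          sub_eq_add_neg]

/-- for positive integers `m ≥ max(n,2)` and real
`α ∈ [0, 1.1√n]`, `(1 + α/n)^n (1 − α/m)^m ≥ 1/7`. -/
theorem stmt_7 (n m : ℕ) (hn : 0 < n) (hm : 0 < m) (hmn : m ≥ max n 2)
    (α : ℝ) (hα : α ∈ Set.Icc (0 : ℝ) (1.1 * Real.sqrt n)) :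
    (1 + α / n) ^ n * (1 - α / m) ^ m ≥ 1 / 7 := by
  obtain ⟨hα0, hα1⟩ := hα
  have hn' : (0 : ℝ) < n := by exact_mod_cast hn
  have hsq : α ^ 2 ≤ 1.21 * n := by
    have h := pow_le_pow_left₀ hα0 hα1 2
    rw [mul_pow, Real.sq_sqrt hn'.le] at h
    linarith
  have hpos : 0 ≤ (1 + α / n) ^ n := by positivity
  rcases Nat.lt_or_ge n 2 with h1 | h2
  · obtain rfl : n = 1 := by omega
    norm_num at hα1 ⊢
    have key := one_sub_div_pow_le_one_sub_div_pow (x := α) two_pos (le_of_max_le_right hmn)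
      (by push_cast; linarith)
    have h : (1 / 5 : ℝ) ≤ (1 - α / m) ^ m := by
      refine le_trans ?_ key
      push_cast
      nlinarith
    nlinarith
  · have h2' : (2 : ℝ) ≤ n := by exact_mod_cast h2
    have key := one_sub_div_pow_le_one_sub_div_pow (x := α) hn (le_of_max_le_left hmn)
      (by nlinarith)
    have key2 := one_sub_div_pow_le_one_sub_div_pow (x := 1.21) two_pos h2 (by norm_num)
    have hfac : 1 - 1.21 / (n : ℝ) ≤ (1 + α / n) * (1 - α / n) := by
      have h : (α / n) ^ 2 ≤ 1.21 / n := by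
        rw [div_pow, div_le_div_iff₀ (by positivity) hn']
        nlinarith
      linarith
    have h0 : 0 ≤ 1 - 1.21 / (n : ℝ) := by
      rw [sub_nonneg, div_le_one hn']
      linarith
    calc (1 / 7 : ℝ) ≤ (1 - 1.21 / (2 : ℕ)) ^ 2 := by norm_num
      _ ≤ (1 - 1.21 / (n : ℝ)) ^ n := key2
      _ ≤ ((1 + α / n) * (1 - α / n)) ^ n := pow_le_pow_left₀ h0 hfac n
      _ = (1 + α / n) ^ n * (1 - α / n) ^ n := mul_pow _ _ _
      _ ≤ (1 + α / n) ^ n * (1 - α / m) ^ m := mul_le_mul_of_nonneg_left key hpos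
end

section
/- For any positive integer k and any integer t with 1 ≤ t ≤ k−1, the binomial probability mass satisfies C(k, t) · (t/k)^t · ((k−t)/k)^(k−t) ≥ 1/(3√t). -/
/-- The upper Stirling bound `n! ≤ e √n (n / e) ^ n`. -/
theorem factorial_le_exp_one_mul_sqrt_mul_pow {n : ℕ} (hn : 1 ≤ n) :
    (n.factorial : ℝ) ≤ Real.exp 1 * Real.sqrt n * (n / Real.exp 1) ^ n := by
  obtain ⟨m, rfl⟩ : ∃ m, n = m + 1 := ⟨n - 1, by omega⟩
  have h : Stirling.stirlingSeq (m + 1) ≤ Stirling.stirlingSeq 1 :=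
    Stirling.stirlingSeq'_antitone (Nat.zero_le m)
  rw [Stirling.stirlingSeq_one, Stirling.stirlingSeq, div_le_iff₀ (by positivity),
    Real.sqrt_mul (by norm_num)] at h
  refine h.trans_eq ?_
  field_simp

theorem exp_one_sq_le_three_mul_sqrt_two_pi :
    Real.exp 1 ^ 2 ≤ 3 * Real.sqrt (2 * Real.pi) := by
  have hs : (2.5 : ℝ) ≤ Real.sqrt (2 * Real.pi) := by
    apply Real.le_sqrt_of_sq_le
    linarith [Real.pi_gt_d2]
  nlinarith [Real.exp_one_lt_d9, Real.exp_pos 1]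

/-- for `1 ≤ t ≤ k−1`,
`C(k,t) (t/k)^t ((k−t)/k)^(k−t) ≥ 1/(3√t)`. -/
theorem stmt_8 (k t : ℕ) (ht : 1 ≤ t) (htk : t ≤ k - 1) (hk : 0 < k) :
    (k.choose t : ℝ) * ((t : ℝ) / k) ^ t * (((k : ℝ) - t) / k) ^ (k - t)
      ≥ 1 / (3 * Real.sqrt t) := by
  obtain ⟨m, rfl⟩ : ∃ m, k = t + m := ⟨k - t, by omega⟩
  have hm : 1 ≤ m := by omega
  have ht0 : (0 : ℝ) < t := by exact_mod_cast ht
  have hm0 : (0 : ℝ) < m := by exact_mod_cast hm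
  have hc : ((t + m).choose t : ℝ) * (t.factorial * m.factorial) = (t + m).factorial := by
    have := Nat.choose_symm_add (a := t) (b := m) ▸
      Nat.add_choose_mul_factorial_mul_factorial t m
    rw [← mul_assoc]
    exact_mod_cast this
  have hk' := Stirling.le_factorial_stirling (t + m)
  have hprod := mul_le_mul (factorial_le_exp_one_mul_sqrt_mul_pow ht)
    (factorial_le_exp_one_mul_sqrt_mul_pow hm) (by positivity) (by positivity)
  rw [← hc, Real.sqrt_mul (by positivity)] at hk'
  have h := hk'.trans (mul_le_mul_of_nonneg_left hprod (Nat.cast_nonneg _))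
  have hsub : ((t + m : ℕ) : ℝ) - t = m := by push_cast; ring
  rw [hsub, Nat.add_sub_cancel_left]
  have hms : Real.sqrt m ≤ Real.sqrt ((t + m : ℕ) : ℝ) :=
    Real.sqrt_le_sqrt (by push_cast; linarith)
  have hst : 0 < Real.sqrt t := Real.sqrt_pos.2 ht0
  have hsm : 0 < Real.sqrt m := Real.sqrt_pos.2 hm0
  have hK : (0 : ℝ) < ((t + m : ℕ) : ℝ) := by exact_mod_cast hk
  have he := Real.exp_pos 1
  have hnum := exp_one_sq_le_three_mul_sqrt_two_pi
  generalize ((t + m : ℕ) : ℝ) = K at *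
  generalize ((t + m).choose t : ℝ) = c at *
  generalize Real.exp 1 = e at *
  have h₁ : Real.sqrt (2 * Real.pi) * Real.sqrt K ≤
      (c * (t / K) ^ t * (m / K) ^ m) * (e ^ 2 * Real.sqrt t * Real.sqrt m) := by
    refine le_of_mul_le_mul_right (h.trans_eq ?_) (by positivity : 0 < (K / e) ^ (t + m))
    simp only [div_pow, pow_add]
    field_simp
  have h₂ : e ^ 2 * Real.sqrt m ≤ 3 * (Real.sqrt (2 * Real.pi) * Real.sqrt K) :=
    (mul_le_mul hnum hms hsm.le (by positivity)).trans_eq (by ring)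
  rw [ge_iff_le, div_le_iff₀ (by positivity)]
  refine le_of_mul_le_mul_right ?_ (by positivity : 0 < e ^ 2 * Real.sqrt m)
  linarith
end

section
/- Let Ω be a finite set, let ε ∈ (0, 1), and let P and Q be probability distributions on Ω with Δ(P, Q) ≤ ε. Then there exist probability distributions N_P and N_Q on Ω such that (1−ε)·P + ε·N_P = (1−ε)·Q + ε·N_Q. Explicitly, one may set A(x) = max(P(x), Q(x)), α = Σ_x A(x) = 1 + Δ(P,Q), N_P = (A/α − (1−ε)P)/ε, and N_Q = (A/α − (1−ε)Q)/ε. -/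
open Finset

/-- The pointwise maximum of two distributions has total mass `1 + TV p q`. -/
theorem IsDist.sum_max {α : Type*} [Fintype α] {p q : α → ℝ} (hp : IsDist p) (hq : IsDist q) :
    ∑ x, max (p x) (q x) = 1 + TV p q := by
  have h : ∀ x, max (p x) (q x) = (1 / 2) * (p x + q x) + (1 / 2) * |p x - q x| := fun x => by
    linarith [max_sub_min_eq_abs (q x) (p x), max_add_min (q x) (p x), max_comm (p x) (q x)]
  simp only [h, sum_add_distrib, ← mul_sum, hp.2, hq.2, TV]
  norm_num

theorem TV_nonneg {α : Type*} [Fintype α] (p q : α → ℝ) : 0 ≤ TV p q :=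
  mul_nonneg (by norm_num) (sum_nonneg fun _ _ => abs_nonneg _)

/-- If `A` dominates a distribution `p` pointwise and its mass `a` satisfies `(1 - ε) * a ≤ 1`,
then removing `(1 - ε) • p` from the normalization of `A` leaves `ε` times a distribution. -/
theorem IsDist.residual {α : Type*} [Fintype α] {p A : α → ℝ} {ε : ℝ} (hp : IsDist p)
    (hε : 0 < ε) (hpA : ∀ x, p x ≤ A x) (hA : 0 < ∑ y, A y) (hmass : (1 - ε) * ∑ y, A y ≤ 1) :
    IsDist fun x => (A x / (∑ y, A y) - (1 - ε) * p x) / ε := by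
  refine ⟨fun x => div_nonneg (sub_nonneg.2 ?_) hε.le, ?_⟩
  · rw [le_div_iff₀ hA]
    calc (1 - ε) * p x * ∑ y, A y = (1 - ε) * (∑ y, A y) * p x := by ring
      _ ≤ 1 * p x := mul_le_mul_of_nonneg_right hmass (hp.1 x)
      _ ≤ A x := by rw [one_mul]; exact hpA x
  · rw [← sum_div, sum_sub_distrib, ← sum_div, ← mul_sum, hp.2, div_self hA.ne']
    field_simp
    ring

/-- if `Δ(P,Q) ≤ ε`, there are "noise" distributions `N_P, N_Q`
with `(1−ε)P + εN_P = (1−ε)Q + εN_Q`; explicitly one may take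
`N_P = (A/α − (1−ε)P)/ε` and `N_Q = (A/α − (1−ε)Q)/ε` where
`A(x) = max(P(x), Q(x))` and `α = Σ_x A(x) = 1 + Δ(P,Q)`. -/
theorem stmt_12 {Ω : Type*} [Fintype Ω] (ε : ℝ) (hε : ε ∈ Set.Ioo (0 : ℝ) 1)
    (P Q : Ω → ℝ) (hP : IsDist P) (hQ : IsDist Q) (hTV : TV P Q ≤ ε) :
    ∃ NP NQ : Ω → ℝ, IsDist NP ∧ IsDist NQ ∧
      (∀ x, (1 - ε) * P x + ε * NP x = (1 - ε) * Q x + ε * NQ x) ∧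
      (∑ x, max (P x) (Q x)) = 1 + TV P Q ∧
      NP = (fun x => (max (P x) (Q x) / (∑ y, max (P y) (Q y)) - (1 - ε) * P x) / ε) ∧
      NQ = (fun x => (max (P x) (Q x) / (∑ y, max (P y) (Q y)) - (1 - ε) * Q x) / ε) := by
  obtain ⟨hε0, -⟩ := hε
  have hsum := hP.sum_max hQ
  have hTV0 := TV_nonneg P Q
  have hpos : 0 < ∑ y, max (P y) (Q y) := by linarith
  have hmass : (1 - ε) * ∑ y, max (P y) (Q y) ≤ 1 := by
    rw [hsum]
    nlinarith
  refine ⟨_, _, hP.residual hε0 (fun x => le_max_left _ _) hpos hmass,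
    hQ.residual hε0 (fun x => le_max_right _ _) hpos hmass, fun x => ?_, hsum, rfl, rfl⟩
  simp only [mul_div_cancel₀ _ hε0.ne', add_sub_cancel]
end

section
/- Fix a positive integer n, a real constant C > 0, and δ₀ ∈ (0,1). Define functions f_{n,t}(ε, m) for positive integers t, ε ∈ (0,1), m > 0 by the recursion: f_{n,1}(ε, m) = 3ε + C·√((n + ln(1/δ₀))/m), and for t ≥ 2, f_{n,t}(ε, m) = max( 3ε/t + C·√((n + ln(1/δ₀))/m), f_{n,t−1}(1 − (1−ε)^((t−1)/t), m/(nt)) ). Then for every positive integer k, every ε ∈ (0, 1/2), and every m > 0, f_{n,k}(ε, m) ≤ 6ε/k + C·√( n^k · k! · (n + ln(1/δ₀)) / m ). -/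
/-- With `L = -log (1 - ε)`, the recursion preserves `L / k` exactly, so the bound
`F k ε m ≤ 3 L / k + C √(n ^ k k! A / m)` is inductive. -/
lemma recursion_le_neg_log {n : ℕ} (hn : 0 < n) {C A : ℝ} (hC : 0 < C) (hA : 0 ≤ A)
    {F : ℕ → ℝ → ℝ → ℝ}
    (hF1 : ∀ ε m : ℝ, F 1 ε m = 3 * ε + C * Real.sqrt (A / m))
    (hFt : ∀ t : ℕ, 2 ≤ t → ∀ ε m : ℝ, F t ε m
      = max (3 * ε / t + C * Real.sqrt (A / m))
          (F (t - 1) (1 - (1 - ε) ^ (((t : ℝ) - 1) / t)) (m / (n * t))))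
    {k : ℕ} (hk : 1 ≤ k) :
    ∀ ε : ℝ, ε < 1 → ∀ m : ℝ, 0 < m →
      F k ε m ≤ 3 * (-Real.log (1 - ε)) / k
        + C * Real.sqrt ((n : ℝ) ^ k * (Nat.factorial k : ℝ) * A / m) := by
  have hfirst : ∀ t : ℕ, ∀ ε : ℝ, ε < 1 → ∀ m : ℝ, 0 < m →
      3 * ε / t + C * Real.sqrt (A / m) ≤ 3 * (-Real.log (1 - ε)) / t
        + C * Real.sqrt ((n : ℝ) ^ t * (Nat.factorial t : ℝ) * A / m) := by
    intro t ε hε m hm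
    have hlog : ε ≤ -Real.log (1 - ε) := by
      linarith [Real.log_le_sub_one_of_pos (sub_pos.2 hε)]
    have hone : (1 : ℝ) ≤ (n : ℝ) ^ t * (Nat.factorial t : ℝ) := by
      exact_mod_cast Nat.mul_pos (pow_pos hn t) t.factorial_pos
    gcongr
    exact le_mul_of_one_le_left hA hone
  induction k, hk using Nat.le_induction with
  | base =>
    intro ε hε m hm
    simpa [hF1] using hfirst 1 ε hε m hm
  | succ k hk ih =>
    intro ε hε m hm
    have hε' : 0 < 1 - ε := sub_pos.2 hε
    have hk0 : (k : ℝ) ≠ 0 := by positivity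
    have hn0 : (n : ℝ) ≠ 0 := by positivity
    rw [hFt (k + 1) (by lia)]
    refine max_le (hfirst _ ε hε m hm) ?_
    have hpow := Real.rpow_pos_of_pos hε' (((k + 1 : ℕ) - 1 : ℝ) / (k + 1 : ℕ))
    refine (ih _ (by linarith) (m / (n * (k + 1 : ℕ))) (by positivity)).trans_eq ?_
    rw [sub_sub_cancel, Real.log_rpow hε', Nat.factorial_succ]
    congr 1
    · push_cast
      field_simp
      ring
    · congr 2
      push_cast
      field_simp
      ring


/-- any function `F` satisfying the recursion
`F 1 ε m = 3ε + C√((n + ln(1/δ₀))/m)` and, for `t ≥ 2`,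
`F t ε m = max(3ε/t + C√((n + ln(1/δ₀))/m), F (t−1) (1−(1−ε)^((t−1)/t)) (m/(nt)))`
satisfies `F k ε m ≤ 6ε/k + C√(n^k k! (n + ln(1/δ₀))/m)` for every `k ≥ 1`,
`ε ∈ (0,1/2)` and `m > 0`. -/
theorem stmt_14 (n : ℕ) (hn : 0 < n) (C : ℝ) (hC : 0 < C)
    (δ₀ : ℝ) (hδ₀ : δ₀ ∈ Set.Ioo (0 : ℝ) 1)
    (F : ℕ → ℝ → ℝ → ℝ)
    (hF1 : ∀ ε m : ℝ, F 1 ε m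
      = 3 * ε + C * Real.sqrt (((n : ℝ) + Real.log (1 / δ₀)) / m))
    (hFt : ∀ t : ℕ, 2 ≤ t → ∀ ε m : ℝ, F t ε m
      = max (3 * ε / t + C * Real.sqrt (((n : ℝ) + Real.log (1 / δ₀)) / m))
          (F (t - 1) (1 - (1 - ε) ^ (((t : ℝ) - 1) / t)) (m / (n * t)))) :
    ∀ k : ℕ, 1 ≤ k → ∀ ε : ℝ, ε ∈ Set.Ioo (0 : ℝ) (1 / 2) → ∀ m : ℝ, 0 < m →
      F k ε m ≤ 6 * ε / k
        + C * Real.sqrt ((n : ℝ) ^ k * (Nat.factorial k : ℝ)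
            * ((n : ℝ) + Real.log (1 / δ₀)) / m) := by
  have hA : (0 : ℝ) ≤ n + Real.log (1 / δ₀) := by
    have := Real.log_nonneg (one_le_one_div hδ₀.1 hδ₀.2.le)
    positivity
  intro k hk ε hε m hm
  have hε' : 0 < 1 - ε := by linarith [hε.2]
  have hlog : -Real.log (1 - ε) ≤ 2 * ε := by
    have hinv : (1 - ε)⁻¹ ≤ 1 + 2 * ε := by
      rw [inv_le_iff_one_le_mul₀ hε']
      nlinarith [hε.1, hε.2]
    linarith [Real.one_sub_inv_le_log_of_pos hε']
  refine (recursion_le_neg_log hn hC hA hF1 hFt hk ε (by linarith) m hm).trans ?_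
  gcongr ?_ / _ + _
  linarith
end

section
/- Let k ≥ 10 be an integer and t an integer with 1 ≤ t ≤ (k−1)/2, and set x₀ = t/(k−1). Then k·C(k−1, t)·x₀^t·(1−x₀)^(k−1−t) ≥ k/(3√t), and moreover for every x ∈ [x₀, x₀ + 1.1·√t/(k−1)], it holds that k·C(k−1, t)·x^t·(1−x)^(k−1−t) ≥ k/(21√t). -/
lemma factorial_le_exp_one_mul_sqrt {n : ℕ} (hn : n ≠ 0) :
    (n.factorial : ℝ) ≤ Real.exp 1 * √n * (n / Real.exp 1) ^ n := by
  obtain ⟨m, rfl⟩ := Nat.exists_eq_succ_of_ne_zero hn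
  have h := Stirling.stirlingSeq'_antitone (Nat.zero_le m)
  simp only [Function.comp, Nat.succ_eq_add_one, zero_add, Stirling.stirlingSeq_one] at h
  rw [Stirling.stirlingSeq, div_le_iff₀ (by positivity), Real.sqrt_mul (by norm_num)] at h
  refine h.trans_eq ?_
  field_simp

/-- A lower bound for the binomial probability at its mean. -/
lemma inv_three_mul_sqrt_le_choose_mul_pow {t m : ℕ} (ht : t ≠ 0) (hm : m ≠ 0) :
    1 / (3 * √t) ≤
      ((t + m).choose t : ℝ) * (t / (t + m : ℝ)) ^ t * (m / (t + m : ℝ)) ^ m := by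
  have hT := factorial_le_exp_one_mul_sqrt ht
  have hM := factorial_le_exp_one_mul_sqrt hm
  have hN := Stirling.le_factorial_stirling (t + m)
  have ht0 : (0 : ℝ) < t := by positivity
  have hm0 : (0 : ℝ) < m := by positivity
  have he := Real.exp_one_lt_d9
  have hsqrt : 5 / 2 * √m ≤ √(2 * Real.pi * (t + m : ℕ)) := by
    apply Real.le_sqrt_of_sq_le
    rw [mul_pow, Real.sq_sqrt hm0.le]
    push_cast
    nlinarith [Real.pi_gt_d2, mul_pos Real.pi_pos ht0]
  have hc : ((t + m).choose t : ℝ) * (t.factorial * m.factorial) = (t + m).factorial := by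
    rw [← mul_assoc, Nat.choose_symm_add]
    exact_mod_cast Nat.add_choose_mul_factorial_mul_factorial t m
  set c : ℝ := ((t + m).choose t : ℝ)
  set e := Real.exp 1
  have he0 : 0 < e := Real.exp_pos 1
  have key : 5 / 2 * √m * ((t + m : ℝ) / e) ^ (t + m) ≤
      c * ((e * √t * (t / e) ^ t) * (e * √m * (m / e) ^ m)) := by
    calc _ ≤ √(2 * Real.pi * (t + m : ℕ)) * ((t + m : ℕ) / e) ^ (t + m) := by
          push_cast at hsqrt ⊢
          gcongr
      _ ≤ ((t + m).factorial : ℝ) := hN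
      _ = c * (t.factorial * m.factorial) := hc.symm
      _ ≤ _ := by gcongr
  have he2 : e ^ 2 ≤ 15 / 2 := by nlinarith
  have key2 : 5 / 2 * (t + m : ℝ) ^ (t + m) ≤ e ^ 2 * (c * √t * t ^ t * m ^ m) := by
    have hp : 0 < √(m : ℝ) / e ^ (t + m) := by positivity
    refine le_of_mul_le_mul_right ?_ hp
    refine le_of_eq_of_le ?_ (key.trans_eq ?_) <;> simp only [div_pow, pow_add] <;> field_simp
  have key3 : (t + m : ℝ) ^ (t + m) ≤ 3 * (c * √t * t ^ t * m ^ m) := by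
    have : 0 ≤ c * √t * t ^ t * m ^ m := by positivity
    nlinarith
  rw [div_le_iff₀ (by positivity), div_pow, div_pow]
  have : c * (t ^ t / (t + m : ℝ) ^ t) * (m ^ m / (t + m : ℝ) ^ m) * (3 * √t) =
      3 * (c * √t * t ^ t * m ^ m) / (t + m : ℝ) ^ (t + m) := by
    rw [pow_add]; field_simp
  rw [this, le_div_iff₀ (by positivity), one_mul]
  exact key3

lemma exp_sub_sq_div_le_one_add_div_pow {t : ℕ} (ht : t ≠ 0) {d : ℝ} (hd : 0 ≤ d) :
    Real.exp (d - d ^ 2 / (2 * t)) ≤ (1 + d / t) ^ t := by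
  have ht0 : (0 : ℝ) < t := by positivity
  rw [← Real.le_log_iff_exp_le (by positivity), Real.log_pow]
  have h := Real.le_log_one_add_of_nonneg (div_nonneg hd ht0.le)
  refine le_trans ?_ (mul_le_mul_of_nonneg_left h ht0.le)
  have h2 : (t : ℝ) * (2 * (d / t) / (d / t + 2)) - (d - d ^ 2 / (2 * t)) =
      d ^ 3 / (2 * t * (d + 2 * t)) := by
    field_simp
    ring
  have : 0 ≤ d ^ 3 / (2 * t * (d + 2 * t)) := by positivity
  linarith

lemma exp_neg_sub_sq_div_le_one_sub_div_pow {m : ℕ} {d : ℝ} (hd : 0 ≤ d) (hdm : d < m) :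
    Real.exp (-d - d ^ 2 / (2 * (m - d))) ≤ (1 - d / m) ^ m := by
  have hm0 : (0 : ℝ) < m := hd.trans_lt hdm
  have hmd : 0 < (m : ℝ) - d := sub_pos.2 hdm
  have hb : 1 - d / m = (m - d) / m := by field_simp
  have hpos : 0 < (m - d) / (m : ℝ) := by positivity
  rw [hb, ← Real.le_log_iff_exp_le (by positivity), Real.log_pow]
  have hlog : Real.sinh (Real.log ((m - d) / m)) ≤ Real.log ((m - d) / m) := by
    rw [Real.sinh_le_self_iff]
    exact Real.log_nonpos hpos.le (by rw [div_le_one hm0]; linarith)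
  rw [Real.sinh_log hpos] at hlog
  refine le_trans (le_of_eq ?_) (mul_le_mul_of_nonneg_left hlog hm0.le)
  field_simp
  ring

lemma exp_le_seven : Real.exp 1.815 ≤ 7 := by
  have h : Real.exp 1.815 * Real.exp 0.185 = Real.exp 1 * Real.exp 1 := by
    rw [← Real.exp_add, ← Real.exp_add]; norm_num
  have h1 := Real.add_one_le_exp (0.185 : ℝ)
  have h2 := Real.exp_one_lt_d9
  nlinarith [Real.exp_pos 1, Real.exp_pos 1.815]

lemma one_seventh_le_one_add_div_pow_mul {t m : ℕ} (ht : t ≠ 0) {d : ℝ} (hd : 0 ≤ d)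
    (hdt : d ^ 2 ≤ 1.21 * t) (hdm : (t : ℝ) / 2 ≤ m - d) :
    1 / 7 ≤ (1 + d / t) ^ t * (1 - d / m) ^ m := by
  have ht0 : (0 : ℝ) < t := by positivity
  have hmd : 0 < (m : ℝ) - d := by linarith
  calc (1 / 7 : ℝ) ≤ Real.exp (-1.815) := by
        rw [Real.exp_neg, ← one_div]
        exact one_div_le_one_div_of_le (Real.exp_pos _) exp_le_seven
    _ ≤ Real.exp ((d - d ^ 2 / (2 * t)) + (-d - d ^ 2 / (2 * (m - d)))) := by
        apply Real.exp_le_exp.2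
        have h1 : d ^ 2 / (2 * t) ≤ 0.605 := by
          rw [div_le_iff₀ (by positivity)]; linarith
        have h2 : d ^ 2 / (2 * (m - d)) ≤ 1.21 := by
          rw [div_le_iff₀ (by positivity)]; linarith
        linarith
    _ ≤ _ := by
        rw [Real.exp_add]
        exact mul_le_mul (exp_sub_sq_div_le_one_add_div_pow ht hd)
          (exp_neg_sub_sq_div_le_one_sub_div_pow hd (by linarith))
          (Real.exp_pos _).le (by positivity)

lemma half_le_sub_mul_sqrt {t m : ℕ} (htm : t ≤ m) (h9 : 9 ≤ t + m) :
    (t : ℝ) / 2 ≤ m - 1.1 * √t := by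
  have hs := Real.sqrt_nonneg (t : ℝ)
  have hsq := Real.sq_sqrt (Nat.cast_nonneg t : (0 : ℝ) ≤ t)
  have htm' : (t : ℝ) ≤ m := by exact_mod_cast htm
  rcases Nat.lt_or_ge t 5 with h | h
  · have h4 : (t : ℝ) ≤ 4 := by exact_mod_cast Nat.le_of_lt_succ h
    have h5 : (5 : ℝ) ≤ m := by exact_mod_cast (by omega : 5 ≤ m)
    nlinarith
  · have h5 : (5 : ℝ) ≤ t := by exact_mod_cast h
    have : 2.2 ≤ √(t : ℝ) := Real.le_sqrt_of_sq_le (by linarith)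
    nlinarith

/-- for `k ≥ 10`, `1 ≤ t ≤ (k−1)/2` and `x₀ = t/(k−1)`, the
magnitude of the derivative `k C(k−1,t) x^t (1−x)^(k−1−t)` is at least
`k/(3√t)` at `x₀` and at least `k/(21√t)` on `[x₀, x₀ + 1.1√t/(k−1)]`. -/
theorem stmt_15 (k t : ℕ) (hk : 10 ≤ k) (ht : 1 ≤ t)
    (htk : (t : ℝ) ≤ ((k : ℝ) - 1) / 2) :
    (k : ℝ) * ((k - 1).choose t : ℝ) * ((t : ℝ) / ((k : ℝ) - 1)) ^ t
        * (1 - (t : ℝ) / ((k : ℝ) - 1)) ^ (k - 1 - t)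
      ≥ (k : ℝ) / (3 * Real.sqrt t) ∧
    ∀ x ∈ Set.Icc ((t : ℝ) / ((k : ℝ) - 1))
        ((t : ℝ) / ((k : ℝ) - 1) + 1.1 * Real.sqrt t / ((k : ℝ) - 1)),
      (k : ℝ) * ((k - 1).choose t : ℝ) * x ^ t * (1 - x) ^ (k - 1 - t)
        ≥ (k : ℝ) / (21 * Real.sqrt t) := by
  have htk' : 2 * t + 1 ≤ k := by
    have : (2 * t + 1 : ℝ) ≤ k := by linarith
    exact_mod_cast this
  obtain ⟨m, rfl⟩ : ∃ m, k = t + m + 1 := ⟨k - 1 - t, by omega⟩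
  have ht0 : t ≠ 0 := by omega
  have hm0 : m ≠ 0 := by omega
  have htp : (0 : ℝ) < t := by positivity
  have hmp : (0 : ℝ) < m := by positivity
  have hk1 : ((t + m + 1 : ℕ) : ℝ) - 1 = t + m := by push_cast; ring
  have hsub : t + m + 1 - 1 = t + m := rfl
  have hsub' : t + m - t = m := by omega
  rw [hk1, hsub, hsub']
  have hmean := inv_three_mul_sqrt_le_choose_mul_pow ht0 hm0
  have hcompl : 1 - (t : ℝ) / (t + m) = m / (t + m) := by field_simp; ring
  set c : ℝ := ((t + m).choose t : ℝ)
  set K : ℝ := ((t + m + 1 : ℕ) : ℝ)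
  have hK : 0 ≤ K := Nat.cast_nonneg _
  refine ⟨?_, fun x ⟨hx1, hx2⟩ => ?_⟩
  · rw [hcompl, ge_iff_le, div_eq_mul_one_div, mul_assoc K, mul_assoc K]
    exact mul_le_mul_of_nonneg_left hmean hK
  · obtain ⟨d, rfl⟩ : ∃ d, x = (t + d) / (t + m) := ⟨x * (t + m) - t, by field_simp; ring⟩
    have hd : 0 ≤ d := by
      rw [div_le_div_iff_of_pos_right (by positivity)] at hx1; linarith
    have hd2 : d ≤ 1.1 * √t := by
      rw [← add_div, div_le_div_iff_of_pos_right (by positivity)] at hx2; linarith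
    have hdt : d ^ 2 ≤ 1.21 * t := by
      calc d ^ 2 ≤ (1.1 * √t) ^ 2 := pow_le_pow_left₀ hd hd2 2
        _ = 1.21 * t := by rw [mul_pow, Real.sq_sqrt htp.le]; norm_num
    have hratio := one_seventh_le_one_add_div_pow_mul (m := m) ht0 hd hdt
      (by linarith [half_le_sub_mul_sqrt (t := t) (m := m) (by omega) (by omega)])
    have hx : (t + d) / (t + m : ℝ) = t / (t + m) * (1 + d / t) := by field_simp
    have hy : 1 - (t + d) / (t + m : ℝ) = m / (t + m) * (1 - d / m) := by field_simp; ring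
    rw [hy, hx, mul_pow, mul_pow]
    calc K / (21 * √t) = K * (1 / (3 * √t) * (1 / 7)) := by field_simp; ring
      _ ≤ K * ((c * (t / (t + m : ℝ)) ^ t * (m / (t + m : ℝ)) ^ m) *
            ((1 + d / t) ^ t * (1 - d / m) ^ m)) := by gcongr
      _ = _ := by ring
end
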